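/- Assume dim V > 1. For every g in the spin group SPIN(V) there is a unique linear isometry τ(g) : V → V with ι(τ(g)v) = g·ι(v)·g* for all v ∈ V; the map g ↦ τ(g) is a group homomorphism from SPIN(V) to the group of linear isometries of V, each τ(g) has determinant 1, τ is surjective onto the special orthogonal group SO(V) (the linear isometries of determinant 1), and its kernel is exactly {1, -1}, so τ : SPIN(V) → SO(V) is a 2-fold covering homomorphism. -/

import Mathlib

open CliffordAlgebra
open scoped RealInnerProductSpace

/-- Membership in the spin group
`SPIN(V) = { g ∈ CLIF₊(V) : g* g = 1, g ι(v) g* ∈ ι(V) for all v }`,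
where `*` is the reversal anti-automorphism. -/
def IsSpin {V : Type*} [NormedAddCommGroup V] [InnerProductSpace ℝ V]
    (Q : QuadraticForm ℝ V) (g : CliffordAlgebra Q) : Prop :=
  g ∈ evenOdd Q 0 ∧ reverse (Q := Q) g * g = 1 ∧
    ∀ v : V, ∃ w : V, g * ι Q v * reverse (Q := Q) g = ι Q w

namespace CliffordAlgebra

section CommRing

variable {R M : Type*} [CommRing R] [AddCommGroup M] [Module R M] {Q : QuadraticForm R M}

theorem equivExterior_ι [Invertible (2 : R)] (v : M) :
    equivExterior Q (ι Q v) = ExteriorAlgebra.ι R v :=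
  changeForm_ι changeForm.associated_neg_proof v

theorem equivExterior_algebraMap [Invertible (2 : R)] (r : R) :
    equivExterior Q (algebraMap R _ r) = algebraMap R (ExteriorAlgebra R M) r :=
  changeForm_algebraMap changeForm.associated_neg_proof r

theorem ι_injective [Invertible (2 : R)] : Function.Injective (ι Q) := by
  intro v w h
  have h' := congrArg (equivExterior Q) h
  rw [equivExterior_ι, equivExterior_ι] at h'
  exact (ExteriorAlgebra.ι_inj R v w).1 h'

theorem algebraMap_injective [Invertible (2 : R)] :
    Function.Injective (algebraMap R (CliffordAlgebra Q)) := by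
  intro r s h
  have h' := congrArg (equivExterior Q) h
  rw [equivExterior_algebraMap, equivExterior_algebraMap] at h'
  exact (ExteriorAlgebra.algebraMap_inj M r s).1 h'

/-- The supercommutator with a vector is contraction with the polar form. -/
theorem ι_mul_sub_involute_mul_ι (v : M) (x : CliffordAlgebra Q) :
    ι Q v * x - involute x * ι Q v = contractLeft (Q.polarBilin v) x := by
  induction x using CliffordAlgebra.left_induction with
  | algebraMap r =>
    rw [AlgHom.commutes, contractLeft_algebraMap, ← Algebra.commutes, sub_self]
  | add x y hx hy => rw [map_add, map_add, ← hx, ← hy]; noncomm_ring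
  | ι_mul x w hx =>
    rw [contractLeft_ι_mul, ← hx, map_mul, involute_ι, Algebra.smul_def,
      QuadraticMap.polarBilin_apply_apply, ← ι_mul_ι_add_swap]
    noncomm_ring

theorem mul_mem_evenOdd {i j k : ZMod 2} (hk : i + j = k) {x y : CliffordAlgebra Q}
    (hx : x ∈ evenOdd Q i) (hy : y ∈ evenOdd Q j) : x * y ∈ evenOdd Q k :=
  hk ▸ evenOdd_mul_le Q i j (Submodule.mul_mem_mul hx hy)

end CommRing

section Field

variable {K M : Type*} [Field K] [AddCommGroup M] [Module K M]

/-- The Euler operator `x ↦ ∑ i, eᵢ ∧ (eᵢ* ⌋ x)` acts on the `n`-th exterior power as `n`. -/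
theorem sum_ι_mul_contractLeft_of_mem_exteriorPower {κ : Type*} [Fintype κ]
    (b : Module.Basis κ K M) {n : ℕ} {x : ExteriorAlgebra K M} (hx : x ∈ ⋀[K]^n M) :
    ∑ i, ExteriorAlgebra.ι K (b i) * contractLeft (Q := (0 : QuadraticForm K M)) (b.coord i) x
      = (n : K) • x := by
  induction hx using Submodule.pow_induction_on_left' with
  | algebraMap r => simp [contractLeft_algebraMap]
  | add x y i hx hy ihx ihy => simp only [map_add, mul_add, Finset.sum_add_distrib, ihx, ihy,
      smul_add]
  | mem_mul m hm i x hx ih =>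
    obtain ⟨v, rfl⟩ := hm
    have key : ∀ j, ExteriorAlgebra.ι K (b j) *
          contractLeft (Q := (0 : QuadraticForm K M)) (b.coord j) (ExteriorAlgebra.ι K v * x)
        = ExteriorAlgebra.ι K (b.coord j v • b j) * x + ExteriorAlgebra.ι K v *
          (ExteriorAlgebra.ι K (b j) *
            contractLeft (Q := (0 : QuadraticForm K M)) (b.coord j) x) := by
      intro j
      have hanti : ExteriorAlgebra.ι K (b j) * ExteriorAlgebra.ι K v
          = -(ExteriorAlgebra.ι K v * ExteriorAlgebra.ι K (b j)) :=
        eq_neg_of_add_eq_zero_left (ExteriorAlgebra.ι_add_mul_swap _ _)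
      rw [ExteriorAlgebra.ι, contractLeft_ι_mul, mul_sub, ← mul_assoc, ← mul_assoc]
      rw [ExteriorAlgebra.ι] at hanti
      rw [hanti, map_smul, smul_mul_assoc, mul_smul_comm, neg_mul, sub_neg_eq_add]
    have hsum : ∑ j, b.coord j v • b j = v := b.sum_repr v
    simp only [key, Finset.sum_add_distrib, ← Finset.mul_sum, ih, ← Finset.sum_mul, ← map_sum,
      hsum]
    rw [mul_smul_comm, Nat.cast_succ, add_smul, one_smul, add_comm]

variable [CharZero K] [FiniteDimensional K M]

theorem _root_.ExteriorAlgebra.mem_range_algebraMap_of_contractLeft_eq_zero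
    {x : ExteriorAlgebra K M}
    (hx : ∀ d : Module.Dual K M, contractLeft (Q := (0 : QuadraticForm K M)) d x = 0) :
    ∃ r : K, x = algebraMap K _ r := by
  classical
  let b := Module.finBasis K M
  let N : ExteriorAlgebra K M →ₗ[K] ExteriorAlgebra K M :=
    ∑ i, LinearMap.mulLeft K (ExteriorAlgebra.ι K (b i)) ∘ₗ
      contractLeft (Q := (0 : QuadraticForm K M)) (b.coord i)
  have hN : ∀ n, ∀ y ∈ ⋀[K]^n M, N y = (n : K) • y := fun n y hy => by
    simpa [N] using sum_ι_mul_contractLeft_of_mem_exteriorPower b hy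
  have hproj : ∀ (n : ℕ) (y : ExteriorAlgebra K M),
      (DirectSum.decompose (fun i : ℕ => ⋀[K]^i M) (N y) n : ExteriorAlgebra K M)
        = (n : K) • (DirectSum.decompose (fun i : ℕ => ⋀[K]^i M) y n : ExteriorAlgebra K M) := by
    intro n y
    induction y using DirectSum.Decomposition.inductionOn (fun i : ℕ => ⋀[K]^i M) with
    | zero => simp
    | @homogeneous i m =>
      rw [hN i m m.2, DirectSum.decompose_smul, DirectSum.decompose_coe, DirectSum.smul_apply]
      by_cases h : i = n
      · subst h; simp
      · simp [DirectSum.of_eq_of_ne _ _ _ (Ne.symm h)]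
    | add m m' h h' => simp [h, h', DirectSum.decompose_add]
  have hN0 : N x = 0 := by simp [N, hx]
  have hz : ∀ n ≠ 0,
      (DirectSum.decompose (fun i : ℕ => ⋀[K]^i M) x n : ExteriorAlgebra K M) = 0 := by
    intro n hn
    have := hproj n x
    rw [hN0, DirectSum.decompose_zero] at this
    exact (smul_eq_zero.1 this.symm).resolve_left (Nat.cast_ne_zero.2 hn)
  have hx0 : x ∈ ⋀[K]^0 M := by
    rw [← DirectSum.sum_support_decompose (fun i : ℕ => ⋀[K]^i M) x]
    refine Submodule.sum_mem _ fun n _ => ?_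
    by_cases hn : n = 0
    · subst hn; exact SetLike.coe_mem _
    · rw [hz n hn]; exact zero_mem _
  obtain ⟨r, hr⟩ := Submodule.mem_one.1 hx0
  exact ⟨r, hr.symm⟩

theorem mem_range_algebraMap_of_contractLeft_eq_zero {Q : QuadraticForm K M}
    {x : CliffordAlgebra Q} (hx : ∀ d : Module.Dual K M, contractLeft d x = 0) :
    ∃ r : K, x = algebraMap K _ r := by
  have : Invertible (2 : K) := invertibleOfNonzero two_ne_zero
  obtain ⟨r, hr⟩ := ExteriorAlgebra.mem_range_algebraMap_of_contractLeft_eq_zero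
    (x := equivExterior Q x) fun d => by
      have h := changeForm_contractLeft (changeForm.associated_neg_proof (Q := Q)) d x
      rw [hx d, map_zero] at h
      exact h.symm
  refine ⟨r, (equivExterior Q).injective ?_⟩
  rw [hr]
  exact (equivExterior_algebraMap r).symm

end Field

end CliffordAlgebra

section Euclidean

variable {V : Type*} [NormedAddCommGroup V] [InnerProductSpace ℝ V] {Q : QuadraticForm ℝ V}

theorem ι_mul_self_eq_neg_norm_sq (hQ : ∀ v : V, Q v = -⟪v, v⟫) (v : V) :
    ι Q v * ι Q v = -algebraMap ℝ _ (‖v‖ ^ 2) := by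
  rw [ι_sq_scalar, hQ, real_inner_self_eq_norm_sq, map_neg]

theorem polar_eq_neg_two_mul_inner (hQ : ∀ v : V, Q v = -⟪v, v⟫) (v w : V) :
    QuadraticMap.polar Q v w = -2 * ⟪v, w⟫ := by
  rw [QuadraticMap.polar, hQ, hQ, hQ, real_inner_add_add_self]
  ring

theorem ι_mul_ι_mul_ι_eq_reflection (hQ : ∀ v : V, Q v = -⟪v, v⟫) {u : V} (hu : ‖u‖ = 1)
    (v : V) : ι Q ((ℝ ∙ u)ᗮ.reflection v) = ι Q u * ι Q v * ι Q u := by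
  have hs := ι_mul_ι_add_swap (Q := Q) u v
  have hr : (ℝ ∙ u)ᗮ.reflection v = v - (2 * ⟪u, v⟫) • u := by
    rw [Submodule.reflection_orthogonal_apply, Submodule.reflection_singleton_apply, hu]
    simp [mul_smul, two_smul]
  rw [eq_sub_of_add_eq hs, sub_mul, mul_assoc, ι_mul_self_eq_neg_norm_sq hQ, hu,
    polar_eq_neg_two_mul_inner hQ, hr, ← Algebra.smul_def]
  simp only [map_sub, map_smul, one_pow, map_one]
  rw [mul_neg, mul_one, sub_neg_eq_add, neg_mul, neg_smul]
  abel

theorem IsSpin.mul {g h : CliffordAlgebra Q} (hg : IsSpin Q g) (hh : IsSpin Q h) :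
    IsSpin Q (g * h) := by
  refine ⟨mul_mem_evenOdd (add_zero 0) hg.1 hh.1, ?_, fun v => ?_⟩
  · rw [reverse.map_mul, mul_assoc, ← mul_assoc _ g h, hg.2.1, one_mul, hh.2.1]
  · obtain ⟨w, hw⟩ := hh.2.2 v
    obtain ⟨z, hz⟩ := hg.2.2 w
    exact ⟨z, by rw [← hz, ← hw, reverse.map_mul]; noncomm_ring⟩

variable [FiniteDimensional ℝ V]

theorem eq_algebraMap_of_ι_mul_eq_involute_mul_ι (hQ : ∀ v : V, Q v = -⟪v, v⟫)
    {x : CliffordAlgebra Q} (hx : ∀ v, ι Q v * x = involute x * ι Q v) :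
    ∃ r : ℝ, x = algebraMap ℝ _ r := by
  refine mem_range_algebraMap_of_contractLeft_eq_zero fun d => ?_
  let v := (InnerProductSpace.toDual ℝ V).symm d.toContinuousLinearMap
  have hd : d = Q.polarBilin ((-1 / 2 : ℝ) • v) := by
    ext w
    have hv : ⟪v, w⟫ = d w := by
      simp only [v, InnerProductSpace.toDual_symm_apply]; rfl
    rw [QuadraticMap.polarBilin_apply_apply, polar_eq_neg_two_mul_inner hQ,
      real_inner_smul_left, hv]
    ring
  rw [hd, ← ι_mul_sub_involute_mul_ι, hx, sub_self]

/-- Every isometry `f` is `v ↦ h v h*` for a product `h` of unit vectors; `h` is even or odd, and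
`h* h = h h* = ± 1`, according to the determinant of `f`. -/
theorem exists_ι_apply_eq_mul_ι_mul_reverse (hQ : ∀ v : V, Q v = -⟪v, v⟫) (f : V ≃ₗᵢ[ℝ] V) :
    ∃ h : CliffordAlgebra Q,
      (h ∈ evenOdd Q 0 ∧ LinearMap.det (f.toLinearEquiv : V →ₗ[ℝ] V) = 1 ∨
        h ∈ evenOdd Q 1 ∧ LinearMap.det (f.toLinearEquiv : V →ₗ[ℝ] V) = -1) ∧
      reverse h * h = algebraMap ℝ _ (LinearMap.det (f.toLinearEquiv : V →ₗ[ℝ] V)) ∧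
      h * reverse h = algebraMap ℝ _ (LinearMap.det (f.toLinearEquiv : V →ₗ[ℝ] V)) ∧
      ∀ v, ι Q (f v) = h * ι Q v * reverse h := by
  obtain ⟨l, -, rfl⟩ := f.reflections_generate_dim
  induction l with
  | nil =>
    have hdet : LinearMap.det ((1 : V ≃ₗᵢ[ℝ] V).toLinearEquiv : V →ₗ[ℝ] V) = 1 :=
      LinearMap.det_id
    refine ⟨1, ?_⟩
    simp only [List.map_nil, List.prod_nil, hdet]
    exact ⟨Or.inl ⟨SetLike.one_mem_graded _, trivial⟩, by simp, by simp, by simp⟩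
  | cons u l ih =>
    simp only [List.map_cons, List.prod_cons]
    generalize (l.map fun v => (ℝ ∙ v)ᗮ.reflection).prod = f at ih ⊢
    by_cases hu : u = 0
    · have : (ℝ ∙ u)ᗮ.reflection = 1 := by
        ext v
        rw [Submodule.reflection_mem_subspace_eq_self (by simp [hu])]
        rfl
      rwa [this, one_mul]
    · obtain ⟨h, hp, h1, h2, h3⟩ := ih
      let e := (‖u‖⁻¹ : ℝ) • u
      have he : ‖e‖ = 1 := norm_smul_inv_norm hu
      have hspan : (ℝ ∙ u) = ℝ ∙ e :=
        (Submodule.span_singleton_smul_eq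
          (IsUnit.mk0 _ (inv_ne_zero (norm_ne_zero_iff.2 hu))) u).symm
      have hrefl : (ℝ ∙ u)ᗮ.reflection = (ℝ ∙ e)ᗮ.reflection := by simp only [hspan]
      rw [hrefl]
      have hdr : LinearMap.det ((ℝ ∙ e)ᗮ.reflection.toLinearEquiv : V →ₗ[ℝ] V) = -1 := by
        have := Submodule.det_reflection (𝕜 := ℝ) (ℝ ∙ e)ᗮ
        rw [Submodule.orthogonal_orthogonal, finrank_span_singleton (by
          rintro h0; rw [h0] at he; simp at he), pow_one] at this
        exact this
      have hdet : LinearMap.det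
          (((ℝ ∙ e)ᗮ.reflection * f).toLinearEquiv : V →ₗ[ℝ] V)
          = -LinearMap.det (f.toLinearEquiv : V →ₗ[ℝ] V) := by
        have := LinearMap.det_comp ((ℝ ∙ e)ᗮ.reflection.toLinearEquiv : V →ₗ[ℝ] V)
          (f.toLinearEquiv : V →ₗ[ℝ] V)
        rw [hdr, neg_one_mul] at this
        exact this
      have hee : ι Q e * ι Q e = -1 := by
        rw [ι_mul_self_eq_neg_norm_sq hQ, he]; simp
      rw [hdet, map_neg]
      refine ⟨ι Q e * h, ?_, ?_, ?_, fun v => ?_⟩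
      · rcases hp with ⟨hp, hd⟩ | ⟨hp, hd⟩
        · exact Or.inr ⟨mul_mem_evenOdd (add_zero 1) (ι_mem_evenOdd_one Q e) hp, by rw [hd]⟩
        · exact Or.inl ⟨mul_mem_evenOdd (by decide) (ι_mem_evenOdd_one Q e) hp, by rw [hd, neg_neg]⟩
      · rw [reverse.map_mul, reverse_ι, ← h1]
        calc _ = reverse h * (ι Q e * ι Q e) * h := by noncomm_ring
          _ = _ := by rw [hee]; noncomm_ring
      · rw [reverse.map_mul, reverse_ι]
        calc _ = ι Q e * (h * reverse h) * ι Q e := by noncomm_ring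
          _ = _ := by
            rw [h2, ← Algebra.commutes, mul_assoc, hee]; noncomm_ring
      · rw [LinearIsometryEquiv.coe_mul, Function.comp_apply, ι_mul_ι_mul_ι_eq_reflection hQ he, h3,
          reverse.map_mul, reverse_ι]
        noncomm_ring

theorem IsSpin.exists_linearIsometryEquiv (hQ : ∀ v : V, Q v = -⟪v, v⟫)
    {g : CliffordAlgebra Q} (hg : IsSpin Q g) :
    ∃ f : V ≃ₗᵢ[ℝ] V, ∀ v, ι Q (f v) = g * ι Q v * reverse g := by
  obtain ⟨-, hgg, hv⟩ := hg
  choose w hw using hv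
  let L : V →ₗ[ℝ] V :=
    { toFun := w
      map_add' := fun x y => ι_injective (Q := Q) (by
        rw [map_add, ← hw, ← hw, ← hw, map_add, mul_add, add_mul])
      map_smul' := fun r x => ι_injective (Q := Q) (by
        rw [RingHom.id_apply, map_smul, ← hw, ← hw, map_smul, mul_smul_comm, smul_mul_assoc]) }
  have hnorm : ∀ v, ‖L v‖ = ‖v‖ := by
    intro v
    have h1 : algebraMap ℝ (CliffordAlgebra Q) (‖w v‖ ^ 2) = algebraMap ℝ _ (‖v‖ ^ 2) := by
      rw [← neg_inj, ← ι_mul_self_eq_neg_norm_sq hQ, ← ι_mul_self_eq_neg_norm_sq hQ]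
      have hc : ∀ u : V, ι Q u * ι Q u = reverse g * g * (ι Q u * ι Q u) := fun u => by
        rw [hgg, one_mul]
      have hcomm : ∀ u : V, ∀ y : CliffordAlgebra Q,
          ι Q u * ι Q u * y = y * (ι Q u * ι Q u) := fun u y => by
        rw [ι_sq_scalar, Algebra.commutes]
      calc ι Q (w v) * ι Q (w v) = reverse g * (ι Q (w v) * ι Q (w v)) * g := by
            rw [mul_assoc, hcomm, ← mul_assoc, hgg, one_mul]
        _ = (reverse g * g) * ι Q v * (reverse g * g) * ι Q v * (reverse g * g) := by
            rw [← hw]; noncomm_ring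
        _ = ι Q v * ι Q v := by rw [hgg]; noncomm_ring
    exact (sq_eq_sq₀ (norm_nonneg _) (norm_nonneg _)).1 (algebraMap_injective h1)
  exact ⟨LinearIsometry.toLinearIsometryEquiv ⟨L, hnorm⟩ rfl, fun v => (hw v).symm⟩

theorem IsSpin.det_eq_one (hQ : ∀ v : V, Q v = -⟪v, v⟫) {g : CliffordAlgebra Q}
    (hg : IsSpin Q g) {f : V ≃ₗᵢ[ℝ] V} (hf : ∀ v, ι Q (f v) = g * ι Q v * reverse g) :
    LinearMap.det (f.toLinearEquiv : V →ₗ[ℝ] V) = 1 := by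
  obtain ⟨h, ⟨-, hd⟩ | ⟨hodd, hd⟩, h1, h2, h3⟩ := exists_ι_apply_eq_mul_ι_mul_reverse hQ f
  · exact hd
  exfalso
  rw [hd, map_neg, map_one] at h1 h2
  have hinv : involute (reverse h * g) = -(reverse h * g) := by
    rw [map_mul, ← reverse_involute, involute_eq_of_mem_odd hodd,
      involute_eq_of_mem_even hg.1, map_neg, neg_mul]
  have hcomm : ∀ v, ι Q v * (reverse h * g) = involute (reverse h * g) * ι Q v := by
    intro v
    have hv : reverse h * (g * ι Q v * reverse g) * g = reverse h * (h * ι Q v * reverse h) * g := by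
      rw [← hf, ← h3]
    have hl : reverse h * (g * ι Q v * reverse g) * g
        = reverse h * g * ι Q v * (reverse g * g) := by noncomm_ring
    have hr : reverse h * (h * ι Q v * reverse h) * g
        = (reverse h * h) * (ι Q v * (reverse h * g)) := by noncomm_ring
    rw [hl, hr, hg.2.1, h1, mul_one, neg_one_mul] at hv
    rw [hinv, neg_mul, hv, neg_neg]
  obtain ⟨r, hr⟩ := eq_algebraMap_of_ι_mul_eq_involute_mul_ι hQ hcomm
  rw [hr, AlgHom.commutes, ← map_neg] at hinv
  have hr0 : r = 0 := by linarith [algebraMap_injective hinv]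
  rw [hr0, map_zero] at hr
  have h0 : (-1 : CliffordAlgebra Q) = 0 := by
    calc (-1 : CliffordAlgebra Q) = -(reverse g * g) := by rw [hg.2.1]
      _ = reverse g * (h * reverse h) * g := by rw [h2]; noncomm_ring
      _ = reverse g * h * (reverse h * g) := by noncomm_ring
      _ = 0 := by rw [hr, mul_zero]
  exact neg_ne_zero.2 one_ne_zero h0

theorem IsSpin.eq_one_or_eq_neg_one (hQ : ∀ v : V, Q v = -⟪v, v⟫) {g : CliffordAlgebra Q}
    (hg : IsSpin Q g) (hf : ∀ v, ι Q v = g * ι Q v * reverse g) : g = 1 ∨ g = -1 := by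
  obtain ⟨r, rfl⟩ := eq_algebraMap_of_ι_mul_eq_involute_mul_ι hQ (x := g) fun v => by
    rw [involute_eq_of_mem_even hg.1]
    nth_rw 1 [hf v]
    rw [mul_assoc, hg.2.1, mul_one]
  have h1 := hg.2.1
  rw [reverse.commutes, ← map_mul, ← map_one (algebraMap ℝ (CliffordAlgebra Q))] at h1
  rcases mul_self_eq_one_iff.1 (algebraMap_injective h1) with rfl | rfl
  · left; simp
  · right; simp

end Euclidean

/-- For `dim V > 1`: every `g ∈ SPIN(V)` determines a unique linear isometry
`τ(g)` of `V` with `ι(τ(g)v) = g ι(v) g*`; `τ` is multiplicative, each `τ(g)` has determinant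
`1`, `τ` is surjective onto `SO(V)`, and its kernel is `{1, -1}`: a 2-fold covering
`τ : SPIN(V) → SO(V)`. -/
theorem spin_covering_of_SO
    (V : Type*) [NormedAddCommGroup V] [InnerProductSpace ℝ V] [FiniteDimensional ℝ V]
    (hdim : 1 < Module.finrank ℝ V)
    (Q : QuadraticForm ℝ V) (hQ : ∀ v : V, Q v = -⟪v, v⟫) :
    ∃ τ : CliffordAlgebra Q → (V ≃ₗᵢ[ℝ] V),
      (∀ g, IsSpin Q g → ∀ v : V, ι Q (τ g v) = g * ι Q v * reverse (Q := Q) g) ∧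
      (∀ g, IsSpin Q g → ∀ f : V ≃ₗᵢ[ℝ] V,
        (∀ v : V, ι Q (f v) = g * ι Q v * reverse (Q := Q) g) → f = τ g) ∧
      (∀ g h, IsSpin Q g → IsSpin Q h → τ (g * h) = (τ h).trans (τ g)) ∧
      (∀ g, IsSpin Q g → LinearMap.det ((τ g).toLinearEquiv : V →ₗ[ℝ] V) = 1) ∧
      (∀ f : V ≃ₗᵢ[ℝ] V, LinearMap.det (f.toLinearEquiv : V →ₗ[ℝ] V) = 1 →
        ∃ g, IsSpin Q g ∧ τ g = f) ∧
      (∀ g, IsSpin Q g → (τ g = LinearIsometryEquiv.refl ℝ V ↔ g = 1 ∨ g = -1)) := by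
  classical
  have hex : ∀ g : CliffordAlgebra Q, ∃ f : V ≃ₗᵢ[ℝ] V,
      IsSpin Q g → ∀ v, ι Q (f v) = g * ι Q v * reverse (Q := Q) g := fun g => by
    by_cases hg : IsSpin Q g
    · obtain ⟨f, hf⟩ := hg.exists_linearIsometryEquiv hQ
      exact ⟨f, fun _ => hf⟩
    · exact ⟨LinearIsometryEquiv.refl ℝ V, fun h => absurd h hg⟩
  choose τ hτ using hex
  have huniq : ∀ g, IsSpin Q g → ∀ f : V ≃ₗᵢ[ℝ] V,
      (∀ v : V, ι Q (f v) = g * ι Q v * reverse (Q := Q) g) → f = τ g := fun g hg f hf => by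
    ext v
    exact ι_injective (Q := Q) (by rw [hf, hτ g hg])
  refine ⟨τ, hτ, huniq, fun g h hg hh => ?_, fun g hg => hg.det_eq_one hQ (hτ g hg),
    fun f hf => ?_, fun g hg => ⟨fun h => ?_, fun h => ?_⟩⟩
  · refine (huniq _ (hg.mul hh) _ fun v => ?_).symm
    rw [LinearIsometryEquiv.trans_apply, hτ g hg, hτ h hh, reverse.map_mul]
    noncomm_ring
  · obtain ⟨h, hp, h1, -, h3⟩ := exists_ι_apply_eq_mul_ι_mul_reverse hQ f
    rw [hf] at hp h1
    have hspin : IsSpin Q h := by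
      refine ⟨?_, by rw [h1, map_one], fun v => ⟨f v, (h3 v).symm⟩⟩
      rcases hp with ⟨hp, -⟩ | ⟨-, hp⟩
      · exact hp
      · norm_num at hp
    exact ⟨h, hspin, (huniq h hspin f h3).symm⟩
  · refine hg.eq_one_or_eq_neg_one hQ fun v => ?_
    rw [← hτ g hg, h]
    rfl
  · refine (huniq g hg _ fun v => ?_).symm
    rcases h with rfl | rfl <;> simp
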